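/- Let e₁*, e₂*, e₃* be real numbers with |e₁*|, |e₂*|, |e₃*| ≤ 1, let A, B ∈ SO(3), and let R = B·diag(e₁*,e₂*,e₃*)·A. Let T be the real 3×2 matrix whose columns are the first two columns of R, and let t₁ ≥ t₂ ≥ 0 be such that t₁² and t₂² are the eigenvalues (with multiplicity) of the 2×2 matrix Tᵀ·T. Then: (a) for every O_B ∈ SO(3), writing R' = O_B·R and letting S' be the upper-left 2×2 submatrix of R', for every d₁, d₂ ∈ ℝ and U', V' ∈ SO(2) with S' = V'·diag(d₁,d₂)·U', one has 1 − h₂((1+d₁)/2) − h₂((1+d₂)/2) + h₂((1+√(R'₁₁² + R'₂₁²))/2) − h₂((1+R'₁₁)/2) ≤ 1 − h₂((1+t₁)/2) − h₂((1+t₂)/2); and (b) there exist O_B ∈ SO(3), d₁, d₂ ∈ ℝ and U', V' ∈ SO(2) as above for which equality holds. -/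

import Mathlib

/-- Binary entropy function (base-2 logarithm), with the convention `0 * log 0 = 0`. -/
noncomputable def h2 (p : ℝ) : ℝ := -(p * Real.logb 2 p) - (1 - p) * Real.logb 2 (1 - p)

/-- `M` is a real 3×3 special orthogonal matrix. -/
def SO3 (M : Matrix (Fin 3) (Fin 3) ℝ) : Prop := M.transpose * M = 1 ∧ M.det = 1

/-- `M` is a real 2×2 special orthogonal matrix. -/
def SO2 (M : Matrix (Fin 2) (Fin 2) ℝ) : Prop := M.transpose * M = 1 ∧ M.det = 1

/-- Upper-left 2×2 submatrix of a 3×3 real matrix. -/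
def sub2 (M : Matrix (Fin 3) (Fin 3) ℝ) : Matrix (Fin 2) (Fin 2) ℝ :=
  !![M 0 0, M 0 1; M 1 0, M 1 1]

/-- The symmetrised binary entropy `x ↦ h₂((1 + x) / 2)` is antitone in `|x|` on `[-1, 1]`. -/
lemma h2_half_add_le {x y : ℝ} (hxy : x ^ 2 ≤ y ^ 2) (hy : y ^ 2 ≤ 1) :
    h2 ((1 + y) / 2) ≤ h2 ((1 + x) / 2) := by
  have key (p : ℝ) : h2 p = Real.binEntropy p / Real.log 2 := by
    simp only [h2, Real.logb, Real.binEntropy, Real.log_inv]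
    ring
  have habs (z : ℝ) : Real.binEntropy ((1 + z) / 2) = Real.binEntropy ((1 + |z|) / 2) := by
    rcases abs_cases z with ⟨h, -⟩ | ⟨h, -⟩
    · rw [h]
    · rw [h, ← Real.binEntropy_one_sub]
      congr 1
      ring
  have hxy' : |x| ≤ |y| := sq_le_sq.mp hxy
  have hy' : |y| ≤ 1 := (sq_le_one_iff_abs_le_one y).mp hy
  have hx0 := abs_nonneg x
  rw [key, key, habs x, habs y]
  refine div_le_div_of_nonneg_right ?_ (Real.log_nonneg one_le_two)
  refine Real.binEntropy_strictAntiOn.antitoneOn ?_ ?_ (by linarith) <;> constructor <;>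
    norm_num <;> linarith

lemma h2_half_add_congr {x y : ℝ} (hxy : x ^ 2 = y ^ 2) :
    h2 ((1 + y) / 2) = h2 ((1 + x) / 2) := by
  rcases sq_eq_sq_iff_eq_or_eq_neg.mp hxy with rfl | rfl
  · rfl
  · simp only [h2]
    ring_nf

/-- Interlacing for a rank-one perturbation of a `2 × 2` diagonal matrix, in terms of the
trace and the determinant of the perturbed matrix. -/
lemma interlacing_of_le {s₁ s₂ a b x y : ℝ} (hs : s₂ ≤ s₁) (hab : b ≤ a)
    (htr : s₁ + s₂ = a + b + x ^ 2 + y ^ 2)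
    (hdet : s₁ * s₂ = a * b + a * y ^ 2 + b * x ^ 2) : a ≤ s₁ ∧ b ≤ s₂ := by
  have ha : (a - s₁) * (a - s₂) = x ^ 2 * (b - a) := by linear_combination -a * htr + hdet
  have hb : (b - s₁) * (b - s₂) = y ^ 2 * (a - b) := by linear_combination -b * htr + hdet
  have h1 : a ≤ s₁ := by
    by_contra! h
    nlinarith [mul_pos (sub_pos.mpr h) (sub_pos.mpr (hs.trans_lt h)),
      mul_nonneg (sq_nonneg x) (sub_nonneg.mpr hab)]
  refine ⟨h1, ?_⟩
  by_contra! h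
  have hbs : b < s₁ := by nlinarith [sq_nonneg x, sq_nonneg y]
  nlinarith [mul_pos (sub_pos.mpr h) (sub_pos.mpr hbs),
    mul_nonneg (sq_nonneg y) (sub_nonneg.mpr hab)]

lemma SO3.mul {M N : Matrix (Fin 3) (Fin 3) ℝ} (hM : SO3 M) (hN : SO3 N) : SO3 (M * N) := by
  refine ⟨?_, by rw [Matrix.det_mul, hM.2, hN.2, one_mul]⟩
  rw [Matrix.transpose_mul, Matrix.mul_assoc, ← Matrix.mul_assoc M.transpose, hM.1,
    Matrix.one_mul, hN.1]

lemma SO3.gram_mul {M : Matrix (Fin 3) (Fin 3) ℝ} (hM : SO3 M) (N : Matrix (Fin 3) (Fin 3) ℝ) :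
    (M * N).transpose * (M * N) = N.transpose * N := by
  rw [Matrix.transpose_mul, Matrix.mul_assoc, ← Matrix.mul_assoc M.transpose, hM.1,
    Matrix.one_mul]

lemma exists_rotation_eq_zero (x y : ℝ) : ∃ c s : ℝ, c ^ 2 + s ^ 2 = 1 ∧ c * y - s * x = 0 := by
  have hc := Complex.norm_mul_cos_arg ⟨x, y⟩
  have hs := Complex.norm_mul_sin_arg ⟨x, y⟩
  simp only at hc hs
  refine ⟨_, _, Real.cos_sq_add_sin_sq (Complex.arg ⟨x, y⟩), ?_⟩
  linear_combination Real.sin (Complex.arg ⟨x, y⟩) * hc - Real.cos (Complex.arg ⟨x, y⟩) * hs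

lemma SO3_rotation_zero_one {c s : ℝ} (h : c ^ 2 + s ^ 2 = 1) :
    SO3 !![c, s, 0; -s, c, 0; 0, 0, 1] := by
  constructor
  · ext i j
    fin_cases i <;> fin_cases j <;> simp [Matrix.mul_apply, Fin.sum_univ_three] <;>
      first | linear_combination h | ring
  · simp [Matrix.det_fin_three]
    linear_combination h

lemma SO3_rotation_one_two {c s : ℝ} (h : c ^ 2 + s ^ 2 = 1) :
    SO3 !![1, 0, 0; 0, c, s; 0, -s, c] := by
  constructor
  · ext i j
    fin_cases i <;> fin_cases j <;> simp [Matrix.mul_apply, Fin.sum_univ_three] <;>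
      first | linear_combination h | ring
  · simp [Matrix.det_fin_three]
    linear_combination h

/-- QR decomposition by Givens rotations. -/
lemma exists_SO3_mul_upper_triangular (R : Matrix (Fin 3) (Fin 3) ℝ) :
    ∃ O, SO3 O ∧ (O * R) 1 0 = 0 ∧ (O * R) 2 0 = 0 ∧ (O * R) 2 1 = 0 := by
  obtain ⟨c₁, s₁, h₁, z₁⟩ := exists_rotation_eq_zero (R 1 0) (R 2 0)
  set R₁ := !![1, 0, 0; 0, c₁, s₁; 0, -s₁, c₁] * R with hR₁
  have e₁ : R₁ 2 0 = 0 := by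
    rw [hR₁, Matrix.mul_apply, Fin.sum_univ_three]
    simp
    linear_combination z₁
  obtain ⟨c₂, s₂, h₂, z₂⟩ := exists_rotation_eq_zero (R₁ 0 0) (R₁ 1 0)
  set R₂ := !![c₂, s₂, 0; -s₂, c₂, 0; 0, 0, 1] * R₁ with hR₂
  have e₂ : R₂ 2 0 = 0 := by
    rw [hR₂, Matrix.mul_apply, Fin.sum_univ_three]
    simp [e₁]
  have e₃ : R₂ 1 0 = 0 := by
    rw [hR₂, Matrix.mul_apply, Fin.sum_univ_three]
    simp
    linear_combination z₂
  obtain ⟨c₃, s₃, h₃, z₃⟩ := exists_rotation_eq_zero (R₂ 1 1) (R₂ 2 1)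
  refine ⟨_, ((SO3_rotation_one_two h₃).mul (SO3_rotation_zero_one h₂)).mul
    (SO3_rotation_one_two h₁), ?_⟩
  rw [Matrix.mul_assoc, ← hR₁, Matrix.mul_assoc, ← hR₂]
  refine ⟨?_, ?_, ?_⟩ <;> rw [Matrix.mul_apply, Fin.sum_univ_three] <;> simp [e₂, e₃]
  linear_combination z₃

lemma SO2_rotation (θ : ℝ) :
    SO2 !![Real.cos θ, -Real.sin θ; Real.sin θ, Real.cos θ] := by
  have h := Real.cos_sq_add_sin_sq θ
  constructor
  · ext i j
    fin_cases i <;> fin_cases j <;> simp [Matrix.mul_apply] <;>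
      first | linear_combination h | ring
  · simp [Matrix.det_fin_two]
    linear_combination h

/-- Signed singular value decomposition with rotations as the orthogonal factors. -/
lemma exists_SO2_diagonal (S : Matrix (Fin 2) (Fin 2) ℝ) :
    ∃ (d₁ d₂ : ℝ) (U V : Matrix (Fin 2) (Fin 2) ℝ), SO2 U ∧ SO2 V ∧
      S = V * Matrix.diagonal ![d₁, d₂] * U := by
  set z : ℂ := ⟨(S 0 0 + S 1 1) / 2, (S 1 0 - S 0 1) / 2⟩
  set w : ℂ := ⟨(S 0 0 - S 1 1) / 2, (S 1 0 + S 0 1) / 2⟩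
  have zc : ‖z‖ * Real.cos z.arg = (S 0 0 + S 1 1) / 2 := Complex.norm_mul_cos_arg z
  have zs : ‖z‖ * Real.sin z.arg = (S 1 0 - S 0 1) / 2 := Complex.norm_mul_sin_arg z
  have wc : ‖w‖ * Real.cos w.arg = (S 0 0 - S 1 1) / 2 := Complex.norm_mul_cos_arg w
  have ws : ‖w‖ * Real.sin w.arg = (S 1 0 + S 0 1) / 2 := Complex.norm_mul_sin_arg w
  obtain ⟨φ, hφ⟩ : ∃ φ, φ = (z.arg + w.arg) / 2 := ⟨_, rfl⟩
  obtain ⟨θ, hθ⟩ : ∃ θ, θ = (z.arg - w.arg) / 2 := ⟨_, rfl⟩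
  rw [show z.arg = φ + θ by rw [hφ, hθ]; ring, Real.cos_add] at zc
  rw [show z.arg = φ + θ by rw [hφ, hθ]; ring, Real.sin_add] at zs
  rw [show w.arg = φ - θ by rw [hφ, hθ]; ring, Real.cos_sub] at wc
  rw [show w.arg = φ - θ by rw [hφ, hθ]; ring, Real.sin_sub] at ws
  refine ⟨‖z‖ + ‖w‖, ‖z‖ - ‖w‖, _, _, SO2_rotation θ, SO2_rotation φ, ?_⟩
  ext i j
  fin_cases i <;> fin_cases j <;>
    rw [Matrix.mul_apply, Fin.sum_univ_two, Matrix.mul_diagonal, Matrix.mul_diagonal] <;> simp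
  · linear_combination -zc - wc
  · linear_combination zs - ws
  · linear_combination -zs - ws
  · linear_combination wc - zc

/-- If the upper `2 × 2` block of a `3 × 2` matrix is `V diag(d₁, d₂) U`, the Gram matrix is
orthogonally similar to a rank-one perturbation of `diag(d₁², d₂²)`. -/
lemma gram_trace_det {P : Matrix (Fin 3) (Fin 3) ℝ} {d₁ d₂ : ℝ} {U V : Matrix (Fin 2) (Fin 2) ℝ}
    (hU : SO2 U) (hV : SO2 V) (h : sub2 P = V * Matrix.diagonal ![d₁, d₂] * U) :
    ∃ x y : ℝ, x ^ 2 + y ^ 2 = P 2 0 ^ 2 + P 2 1 ^ 2 ∧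
      (sub2 (P.transpose * P)).trace = d₁ ^ 2 + d₂ ^ 2 + x ^ 2 + y ^ 2 ∧
      (sub2 (P.transpose * P)).det =
        d₁ ^ 2 * d₂ ^ 2 + d₁ ^ 2 * y ^ 2 + d₂ ^ 2 * x ^ 2 := by
  set G := sub2 (P.transpose * P) with hG
  have hU' : U * U.transpose = 1 := mul_eq_one_comm.mp hU.1
  set w : Matrix (Fin 2) (Fin 1) ℝ := Matrix.of fun i _ => ![P 2 0, P 2 1] i with hw
  have hGS : G = (sub2 P).transpose * sub2 P + w * w.transpose := by
    ext i j
    fin_cases i <;> fin_cases j <;>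
      simp [hG, hw, sub2, Matrix.mul_apply, Fin.sum_univ_three]
  have hSS : U * ((sub2 P).transpose * sub2 P) * U.transpose =
      Matrix.diagonal ![d₁ ^ 2, d₂ ^ 2] := by
    have : U * ((sub2 P).transpose * sub2 P) * U.transpose =
        (U * U.transpose) * Matrix.diagonal ![d₁, d₂] * (V.transpose * V) *
          Matrix.diagonal ![d₁, d₂] * (U * U.transpose) := by
      rw [h]
      simp only [Matrix.transpose_mul, Matrix.diagonal_transpose, Matrix.mul_assoc]
    rw [this, hU', hV.1, Matrix.one_mul, Matrix.mul_one, Matrix.mul_one,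
      Matrix.diagonal_mul_diagonal]
    congr 1
    ext i
    fin_cases i <;> simp [sq]
  set z := U * w with hz
  have hUG : U * G * U.transpose = Matrix.diagonal ![d₁ ^ 2, d₂ ^ 2] + z * z.transpose := by
    rw [hGS, Matrix.mul_add, Matrix.add_mul, hSS, hz]
    simp only [Matrix.transpose_mul, Matrix.mul_assoc]
  have hzz : z.transpose * z = w.transpose * w := by
    rw [hz, Matrix.transpose_mul, Matrix.mul_assoc, ← Matrix.mul_assoc U.transpose, hU.1,
      Matrix.one_mul]
  have htr : (U * G * U.transpose).trace = G.trace := by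
    rw [Matrix.trace_mul_comm, ← Matrix.mul_assoc, hU.1, Matrix.one_mul]
  have hdet : (U * G * U.transpose).det = G.det := by
    rw [Matrix.det_mul, Matrix.det_mul, Matrix.det_transpose, hU.2, one_mul, mul_one]
  refine ⟨z 0 0, z 1 0, ?_, ?_, ?_⟩
  · have := congrFun (congrFun hzz 0) 0
    simp [Matrix.mul_apply, hw] at this
    linear_combination this
  · rw [← htr, hUG]
    simp [Matrix.trace_fin_two, Matrix.mul_apply]
    ring
  · rw [← hdet, hUG]
    simp [Matrix.det_fin_two, Matrix.mul_apply]
    ring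

/-- The eigenvalues of a `2 × 2` principal block of `Aᵀ diag(m) A`, with `A` orthogonal and
`m ≤ 1`, are at most one. -/
lemma le_one_of_gram {e1 e2 e3 : ℝ} (h1 : |e1| ≤ 1) (h2e : |e2| ≤ 1) (h3 : |e3| ≤ 1)
    {A G : Matrix (Fin 3) (Fin 3) ℝ} (hA : SO3 A)
    (hG : G = A.transpose * Matrix.diagonal ![e1 ^ 2, e2 ^ 2, e3 ^ 2] * A) {s₁ s₂ : ℝ}
    (hs : s₂ ≤ s₁) (htr : s₁ + s₂ = (sub2 G).trace) (hdet : s₁ * s₂ = (sub2 G).det) :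
    G 0 0 ≤ 1 ∧ s₁ ≤ 1 := by
  have p₁ := sub_nonneg.mpr ((sq_le_one_iff_abs_le_one e1).mpr h1)
  have p₂ := sub_nonneg.mpr ((sq_le_one_iff_abs_le_one e2).mpr h2e)
  have p₃ := sub_nonneg.mpr ((sq_le_one_iff_abs_le_one e3).mpr h3)
  obtain ⟨m₁, hm₁⟩ : ∃ m, m = 1 - e1 ^ 2 := ⟨_, rfl⟩
  obtain ⟨m₂, hm₂⟩ : ∃ m, m = 1 - e2 ^ 2 := ⟨_, rfl⟩
  obtain ⟨m₃, hm₃⟩ : ∃ m, m = 1 - e3 ^ 2 := ⟨_, rfl⟩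
  rw [← hm₁] at p₁
  rw [← hm₂] at p₂
  rw [← hm₃] at p₃
  have hI : G = 1 - A.transpose * Matrix.diagonal ![m₁, m₂, m₃] * A := by
    have hd : Matrix.diagonal ![e1 ^ 2, e2 ^ 2, e3 ^ 2] =
        1 - Matrix.diagonal ![m₁, m₂, m₃] := by
      rw [← Matrix.diagonal_one, Matrix.diagonal_sub, hm₁, hm₂, hm₃]
      congr 1
      ext i
      fin_cases i <;> simp
    rw [hG, hd, Matrix.mul_sub, Matrix.sub_mul, Matrix.mul_one, hA.1]
  have g00 : G 0 0 = 1 - (m₁ * A 0 0 ^ 2 + m₂ * A 1 0 ^ 2 + m₃ * A 2 0 ^ 2) := by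
    simp [hI, Matrix.mul_apply, Matrix.diagonal, Fin.sum_univ_three]
    ring
  have g11 : G 1 1 = 1 - (m₁ * A 0 1 ^ 2 + m₂ * A 1 1 ^ 2 + m₃ * A 2 1 ^ 2) := by
    simp [hI, Matrix.mul_apply, Matrix.diagonal, Fin.sum_univ_three]
    ring
  have g01 : G 0 1 = -(m₁ * A 0 0 * A 0 1 + m₂ * A 1 0 * A 1 1 + m₃ * A 2 0 * A 2 1) := by
    simp [hI, Matrix.mul_apply, Matrix.diagonal, Fin.sum_univ_three]
    ring
  have g10 : G 1 0 = -(m₁ * A 0 0 * A 0 1 + m₂ * A 1 0 * A 1 1 + m₃ * A 2 0 * A 2 1) := by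
    simp [hI, Matrix.mul_apply, Matrix.diagonal, Fin.sum_univ_three]
    ring
  have l0 : G 0 0 ≤ 1 := by
    rw [g00]
    have : 0 ≤ m₁ * A 0 0 ^ 2 + m₂ * A 1 0 ^ 2 + m₃ * A 2 0 ^ 2 := by positivity
    linarith
  have l1 : G 1 1 ≤ 1 := by
    rw [g11]
    have : 0 ≤ m₁ * A 0 1 ^ 2 + m₂ * A 1 1 ^ 2 + m₃ * A 2 1 ^ 2 := by positivity
    linarith
  have htr' : s₁ + s₂ = G 0 0 + G 1 1 := by simpa [sub2, Matrix.trace_fin_two] using htr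
  have hdet' : s₁ * s₂ = G 0 0 * G 1 1 - G 0 1 * G 1 0 := by
    simpa [sub2, Matrix.det_fin_two] using hdet
  have hchar : (1 - s₁) * (1 - s₂) = m₁ * m₂ * (A 0 0 * A 1 1 - A 1 0 * A 0 1) ^ 2 +
      m₁ * m₃ * (A 0 0 * A 2 1 - A 2 0 * A 0 1) ^ 2 +
      m₂ * m₃ * (A 1 0 * A 2 1 - A 2 0 * A 1 1) ^ 2 := by
    have : (1 - s₁) * (1 - s₂) = (1 - G 0 0) * (1 - G 1 1) - G 0 1 * G 1 0 := by
      linear_combination hdet' - htr'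
    rw [this, g00, g11, g01, g10]
    ring
  have hchar' : 0 ≤ (1 - s₁) * (1 - s₂) := by
    rw [hchar]
    positivity
  refine ⟨l0, ?_⟩
  by_contra! h
  nlinarith

theorem stmt14 (e1 e2 e3 : ℝ) (h1 : |e1| ≤ 1) (h2e : |e2| ≤ 1) (h3 : |e3| ≤ 1)
    (A B : Matrix (Fin 3) (Fin 3) ℝ) (hA : SO3 A) (hB : SO3 B)
    (R : Matrix (Fin 3) (Fin 3) ℝ)
    (hR : R = B * Matrix.diagonal ![e1, e2, e3] * A)
    (T : Matrix (Fin 3) (Fin 2) ℝ)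
    (hT : ∀ (i : Fin 3) (j : Fin 2), T i j = R i j.castSucc)
    (t1 t2 : ℝ) (ht21 : t2 ≤ t1) (ht2 : 0 ≤ t2)
    (htr : t1 ^ 2 + t2 ^ 2 = (T.transpose * T).trace)
    (hdet : t1 ^ 2 * t2 ^ 2 = (T.transpose * T).det) :
    (∀ OB, SO3 OB →
      ∀ (d1 d2 : ℝ) (U' V' : Matrix (Fin 2) (Fin 2) ℝ), SO2 U' → SO2 V' →
        sub2 (OB * R) = V' * Matrix.diagonal ![d1, d2] * U' →
        1 - h2 ((1 + d1) / 2) - h2 ((1 + d2) / 2)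
            + h2 ((1 + Real.sqrt (((OB * R) 0 0) ^ 2 + ((OB * R) 1 0) ^ 2)) / 2)
            - h2 ((1 + (OB * R) 0 0) / 2)
          ≤ 1 - h2 ((1 + t1) / 2) - h2 ((1 + t2) / 2)) ∧
    (∃ OB, SO3 OB ∧
      ∃ (d1 d2 : ℝ) (U' V' : Matrix (Fin 2) (Fin 2) ℝ), SO2 U' ∧ SO2 V' ∧
        sub2 (OB * R) = V' * Matrix.diagonal ![d1, d2] * U' ∧
        1 - h2 ((1 + d1) / 2) - h2 ((1 + d2) / 2)
            + h2 ((1 + Real.sqrt (((OB * R) 0 0) ^ 2 + ((OB * R) 1 0) ^ 2)) / 2)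
            - h2 ((1 + (OB * R) 0 0) / 2)
          = 1 - h2 ((1 + t1) / 2) - h2 ((1 + t2) / 2)) := by
  have hgram {O : Matrix (Fin 3) (Fin 3) ℝ} (hO : SO3 O) :
      (O * R).transpose * (O * R) =
        A.transpose * Matrix.diagonal ![e1 ^ 2, e2 ^ 2, e3 ^ 2] * A := by
    rw [hO.gram_mul, hR, Matrix.mul_assoc, hB.gram_mul, Matrix.transpose_mul,
      Matrix.diagonal_transpose, Matrix.mul_assoc, ← Matrix.mul_assoc _ _ A,
      Matrix.diagonal_mul_diagonal, Matrix.mul_assoc]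
    congr 3
    ext i
    fin_cases i <;> simp [sq]
  have hTT {O : Matrix (Fin 3) (Fin 3) ℝ} (hO : SO3 O) :
      T.transpose * T = sub2 ((O * R).transpose * (O * R)) := by
    rw [hO.gram_mul]
    ext i j
    fin_cases i <;> fin_cases j <;> simp [sub2, Matrix.mul_apply, hT]
  have hs : t2 ^ 2 ≤ t1 ^ 2 := pow_le_pow_left₀ ht2 ht21 2
  constructor
  · intro O hO d1 d2 U V hU hV hS
    obtain ⟨x, y, -, htr', hdet'⟩ := gram_trace_det hU hV hS
    rw [hTT hO] at htr hdet
    obtain ⟨hcol, ht1⟩ := le_one_of_gram h1 h2e h3 hA (hgram hO) hs htr hdet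
    have hd : h2 ((1 + t1) / 2) + h2 ((1 + t2) / 2) ≤
        h2 ((1 + d1) / 2) + h2 ((1 + d2) / 2) := by
      rcases le_total (d2 ^ 2) (d1 ^ 2) with h | h
      · obtain ⟨i, j⟩ := interlacing_of_le hs h (htr.trans htr') (hdet.trans hdet')
        linarith [h2_half_add_le i ht1, h2_half_add_le j (hs.trans ht1)]
      · obtain ⟨i, j⟩ := interlacing_of_le (x := y) (y := x) hs h
          (by rw [htr, htr']; ring) (by rw [hdet, hdet']; ring)
        linarith [h2_half_add_le i ht1, h2_half_add_le j (hs.trans ht1)]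
    have hn : (Real.sqrt ((O * R) 0 0 ^ 2 + (O * R) 1 0 ^ 2)) ^ 2 =
        (O * R) 0 0 ^ 2 + (O * R) 1 0 ^ 2 := Real.sq_sqrt (by positivity)
    have hcol' : (O * R) 0 0 ^ 2 + (O * R) 1 0 ^ 2 + (O * R) 2 0 ^ 2 ≤ 1 := by
      rw [Matrix.mul_apply, Fin.sum_univ_three] at hcol
      simp only [Matrix.transpose_apply] at hcol
      linarith
    have := h2_half_add_le (x := (O * R) 0 0)
      (y := Real.sqrt ((O * R) 0 0 ^ 2 + (O * R) 1 0 ^ 2))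
      (by rw [hn]; nlinarith [sq_nonneg ((O * R) 1 0)])
      (by rw [hn]; nlinarith [sq_nonneg ((O * R) 2 0)])
    linarith
  · obtain ⟨O, hO, z10, z20, z21⟩ := exists_SO3_mul_upper_triangular R
    obtain ⟨d1, d2, U, V, hU, hV, hS⟩ := exists_SO2_diagonal (sub2 (O * R))
    refine ⟨O, hO, d1, d2, U, V, hU, hV, hS, ?_⟩
    obtain ⟨x, y, hxy, htr', hdet'⟩ := gram_trace_det hU hV hS
    rw [hTT hO] at htr hdet
    rw [z20, z21] at hxy
    have hx : x ^ 2 = 0 := by nlinarith [sq_nonneg x, sq_nonneg y]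
    have hy : y ^ 2 = 0 := by nlinarith [sq_nonneg x, sq_nonneg y]
    have hd : h2 ((1 + d1) / 2) + h2 ((1 + d2) / 2) =
        h2 ((1 + t1) / 2) + h2 ((1 + t2) / 2) := by
      rcases le_total (d2 ^ 2) (d1 ^ 2) with h | h
      · obtain ⟨i, j⟩ := interlacing_of_le hs h (htr.trans htr') (hdet.trans hdet')
        rw [h2_half_add_congr (x := t1) (y := d1) (by linarith),
          h2_half_add_congr (x := t2) (y := d2) (by linarith)]
      · obtain ⟨i, j⟩ := interlacing_of_le (x := y) (y := x) hs h
          (by rw [htr, htr']; ring) (by rw [hdet, hdet']; ring)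
        rw [h2_half_add_congr (x := t2) (y := d1) (by linarith),
          h2_half_add_congr (x := t1) (y := d2) (by linarith), add_comm]
    have hn : h2 ((1 + Real.sqrt ((O * R) 0 0 ^ 2 + (O * R) 1 0 ^ 2)) / 2) =
        h2 ((1 + (O * R) 0 0) / 2) :=
      h2_half_add_congr (by rw [Real.sq_sqrt (by positivity), z10]; ring)
    linarith
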